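/- Let d ≥ 3, k ≥ 2, and let T ⊂ ℝ^d be a clean lattice d-simplex whose interior contains exactly k lattice points and whose volume is Vol(T) = (dk + 1)/d!. Then for any two distinct lattice points w_1, w_2 in the interior of T there exists a vertex v of T such that w_1, w_2, and v are collinear. -/

import Mathlib

open MeasureTheory Set
open scoped ENNReal

noncomputable section

/-- A point of `ℝ^d` is a lattice point if all its coordinates are integers. -/
def IsLatticePt (d : ℕ) (x : Fin d → ℝ) : Prop := ∀ i, ∃ z : ℤ, x i = (z : ℝ)

/-- A lattice `d`-simplex: the convex hull of `d+1` affinely independent points of `ℤ^d`. -/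
def IsLatticeSimplex (d : ℕ) (T : Set (Fin d → ℝ)) : Prop :=
  ∃ v : Fin (d + 1) → Fin d → ℤ,
    AffineIndependent ℝ (fun i => fun j => ((v i j : ℤ) : ℝ)) ∧
    T = convexHull ℝ (Set.range (fun i => fun j => ((v i j : ℤ) : ℝ)))

/-- A lattice `d`-polytope: convex hull of a finite set of lattice points affinely
spanning `ℝ^d`. -/
def IsLatticePolytope (d : ℕ) (P : Set (Fin d → ℝ)) : Prop :=
  ∃ F : Finset (Fin d → ℤ),
    affineSpan ℝ ((fun v : Fin d → ℤ => fun j : Fin d => (v j : ℝ)) '' ↑F) = ⊤ ∧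
    P = convexHull ℝ ((fun v : Fin d → ℤ => fun j : Fin d => (v j : ℝ)) '' ↑F)

/-- Clean: the only lattice points on the boundary are the vertices (extreme points). -/
def IsClean (d : ℕ) (P : Set (Fin d → ℝ)) : Prop :=
  frontier P ∩ {x | IsLatticePt d x} = Set.extremePoints ℝ P

/-- Unimodular equivalence of subsets of `ℝ^d`. -/
def UnimodEquiv (d : ℕ) (P Q : Set (Fin d → ℝ)) : Prop :=
  ∃ (M : Matrix (Fin d) (Fin d) ℤ) (u : Fin d → ℤ),
    (M.det = 1 ∨ M.det = -1) ∧
    (fun x => (M.map (fun z : ℤ => (z : ℝ))).mulVec x + (fun i => (u i : ℝ))) '' P = Q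

/-- `S_d(k) = conv(e_1, …, e_d, -k(e_1 + ⋯ + e_d))`. -/
def Sdk (d k : ℕ) : Set (Fin d → ℝ) :=
  convexHull ℝ
    ((Set.range fun i : Fin d => (Pi.single i 1 : Fin d → ℝ)) ∪ {fun _ => -(k : ℝ)})

/-- `T_{a_1,…,a_d}`: vertex set `{0, e_1, …, e_{d-1}, (a_1,…,a_d)}`. -/
def Ta (d : ℕ) (a : Fin d → ℤ) : Set (Fin d → ℝ) :=
  convexHull ℝ
    ({(0 : Fin d → ℝ)} ∪
      {x | ∃ i : Fin d, i.val < d - 1 ∧ x = (Pi.single i 1 : Fin d → ℝ)} ∪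
      {fun i => (a i : ℝ)})

section Core

set_option linter.unusedSectionVars false

variable {n : Type} [Fintype n] [DecidableEq n]

open Matrix in
/-- coordinates of `w` with respect to the rows of `P`. -/
def crd (P : Matrix n n ℝ) (w : n → ℝ) : n → ℝ := w ᵥ* P⁻¹

/-- support size. -/
def sz (x : n → ℝ) : ℕ := (Finset.univ.filter (fun i => x i ≠ 0)).card

open Classical in
/-- carrier dimension if `w` lies in the simplex, zero otherwise. -/
def cost (P : Matrix n n ℝ) (w : n → ℝ) : ℕ :=
  if ∀ i, 0 ≤ crd P w i then sz (crd P w) - 1 else 0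

open Matrix in
lemma crd_vecMul {P : Matrix n n ℝ} (hP : P.det ≠ 0) (w : n → ℝ) : crd P w ᵥ* P = w := by
  unfold crd
  rw [Matrix.vecMul_vecMul, Matrix.nonsing_inv_mul _ (isUnit_iff_ne_zero.mpr hP), Matrix.vecMul_one]

open Matrix in
lemma crd_eq {P : Matrix n n ℝ} (hP : P.det ≠ 0) {w x : n → ℝ} (h : x ᵥ* P = w) : crd P w = x := by
  unfold crd
  rw [← h, Matrix.vecMul_vecMul, Matrix.mul_nonsing_inv _ (isUnit_iff_ne_zero.mpr hP),
    Matrix.vecMul_one]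

open Matrix in
lemma sum_vecMul {P : Matrix n n ℝ} (hP : ∀ i, ∑ j, P i j = 1) (x : n → ℝ) :
    ∑ j, (x ᵥ* P) j = ∑ i, x i := by
  simp only [Matrix.vecMul, dotProduct]
  rw [Finset.sum_comm]
  simp [← Finset.mul_sum, hP]

lemma sum_crd {P : Matrix n n ℝ} (hP : P.det ≠ 0) (hs : ∀ i, ∑ j, P i j = 1) {w : n → ℝ}
    (hw : ∑ j, w j = 1) : ∑ j, crd P w j = 1 := by
  rw [← sum_vecMul hs, crd_vecMul hP, hw]

open Matrix in
lemma vecMul_updateRow (P : Matrix n n ℝ) (i : n) (u x : n → ℝ) :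
    x ᵥ* (P.updateRow i u) = (Function.update x i 0) ᵥ* P + x i • u := by
  ext j
  simp only [Matrix.vecMul, dotProduct, Pi.add_apply, Pi.smul_apply, smul_eq_mul]
  rw [← Finset.add_sum_erase _ _ (Finset.mem_univ i),
    ← Finset.add_sum_erase _ (fun l => Function.update x i 0 l * P l j) (Finset.mem_univ i)]
  simp only [Matrix.updateRow_self, Function.update_self, zero_mul, zero_add]
  rw [add_comm]
  congr 1
  apply Finset.sum_congr rfl
  intro l hl
  have : l ≠ i := Finset.ne_of_mem_erase hl
  simp [Matrix.updateRow_ne this, Function.update_of_ne this]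

open Matrix in
lemma det_updateRow_crd {P : Matrix n n ℝ} (hP : P.det ≠ 0) (i : n) (u : n → ℝ) :
    (P.updateRow i u).det = crd P u i * P.det := by
  have h := Matrix.det_updateRow_sum P i (crd P u)
  rw [smul_eq_mul] at h
  rw [← h]
  congr 2
  conv_lhs => rw [← crd_vecMul hP u]
  rw [Matrix.vecMul_eq_sum]

open Matrix in
lemma crd_updateRow {P : Matrix n n ℝ} (hP : P.det ≠ 0) (i : n) (u w : n → ℝ)
    (hi : crd P u i ≠ 0) :
    crd (P.updateRow i u) w =
      Function.update (crd P w - (crd P w i / crd P u i) • crd P u) i (crd P w i / crd P u i) := by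
  apply crd_eq
  · rw [det_updateRow_crd hP]; exact mul_ne_zero hi hP
  rw [vecMul_updateRow]
  simp only [Function.update_idem, Function.update_self]
  have : Function.update (crd P w - (crd P w i / crd P u i) • crd P u) i 0
      = (crd P w - (crd P w i / crd P u i) • crd P u) := by
    rw [Function.update_eq_self_iff]
    simp only [Pi.sub_apply, Pi.smul_apply, smul_eq_mul]
    field_simp; ring
  rw [this, Matrix.sub_vecMul, Matrix.smul_vecMul, crd_vecMul hP, crd_vecMul hP]
  simp

/-- Combinatorial step: stellar subdivision at `y` does not lose carrier dimension of `z`. -/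
lemma stellar_step (y z : n → ℝ) (hy0 : ∀ i, 0 ≤ y i) (hz0 : ∀ i, 0 ≤ z i)
    (hys : ∑ i, y i = 1) (hzs : ∑ i, z i = 1) (hne : z ≠ y) :
    ∃ I : Finset n, (∀ i ∈ I, y i ≠ 0) ∧
      (∀ i ∈ I, ∀ j, 0 ≤ Function.update (z - (z i / y i) • y) i (z i / y i) j) ∧
      sz z - 1 ≤ ∑ i ∈ I, (sz (Function.update (z - (z i / y i) • y) i (z i / y i)) - 1) := by
  classical
  let U : Finset n := Finset.univ.filter (fun i => y i ≠ 0)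
  have hU : U.Nonempty := by
    by_contra h
    have h0 : ∀ i, y i = 0 := by
      intro i
      by_contra hi
      exact h ⟨i, by simp [U, hi]⟩
    simp [h0] at hys
  obtain ⟨i0, hi0, hmin⟩ := Finset.exists_min_image U (fun i => z i / y i) hU
  set t := z i0 / y i0 with ht
  have ht0 : 0 ≤ t := div_nonneg (hz0 _) (hy0 _)
  have hyU : ∀ i, i ∈ U ↔ y i ≠ 0 := by intro i; simp [U]
  have hg0 : ∀ j, 0 ≤ z j - t * y j := by
    intro j
    by_cases hj : y j = 0
    · simp [hj, hz0]
    · have := hmin j ((hyU j).2 hj)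
      have hp : 0 < y j := lt_of_le_of_ne (hy0 j) (Ne.symm hj)
      rw [le_div_iff₀ hp] at this
      linarith
  let I : Finset n := U.filter (fun i => z i / y i = t)
  have hI : ∀ i ∈ I, y i ≠ 0 ∧ z i / y i = t := by
    intro i hi
    simp only [I, Finset.mem_filter, hyU] at hi
    exact hi
  have hi0I : i0 ∈ I := by simp [I, hi0, ht]
  rcases ht0.eq_or_lt with h0 | hpos
  · refine ⟨{i0}, ?_, ?_, ?_⟩
    · simpa using (hyU i0).1 hi0
    · intro i hi j
      rw [Finset.mem_singleton] at hi
      subst hi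
      rw [← ht, ← h0]
      by_cases hji : j = i
      · subst hji; simp
      · simp [Function.update_of_ne hji, hz0]
    · rw [Finset.sum_singleton, ← ht, ← h0]
      have hzi : z i0 = 0 := by
        have := (hI i0 hi0I).1
        rw [ht, eq_comm, div_eq_zero_iff] at h0
        tauto
      have : Function.update (z - (0:ℝ) • y) i0 0 = z := by
        rw [Function.update_eq_iff]; simp [hzi]
      rw [this]
  · refine ⟨I, fun i hi => (hI i hi).1, ?_, ?_⟩
    · intro i hi j
      rw [(hI i hi).2]
      by_cases hji : j = i
      · subst hji; simp [ht0]
      · simpa [Function.update_of_ne hji] using hg0 j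
    · let G : Finset n := Finset.univ.filter (fun j => z j - t * y j ≠ 0)
      have hsz : ∀ i ∈ I, sz (Function.update (z - (z i / y i) • y) i (z i / y i)) - 1 = G.card := by
        intro i hi
        rw [(hI i hi).2]
        have hiG : i ∉ G := by
          have h1 := (hI i hi).2
          have h2 := (hI i hi).1
          simp only [G, Finset.mem_filter, Finset.mem_univ, true_and, not_not]
          rw [← h1]; field_simp; ring
        have : (Finset.univ.filter (fun j => Function.update (z - t • y) i t j ≠ 0)) = insert i G := by
          ext j
          by_cases hji : j = i
          · subst hji; simp [hpos.ne']
          · simp [hji, G]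
        unfold sz
        rw [this, Finset.card_insert_of_notMem hiG]; simp
      rw [Finset.sum_congr rfl hsz, Finset.sum_const, smul_eq_mul]
      have hzsub : sz z ≤ I.card + G.card := by
        unfold sz
        refine le_trans (Finset.card_le_card ?_) (Finset.card_union_le I G)
        intro j hj
        simp only [Finset.mem_filter, Finset.mem_univ, true_and] at hj
        rw [Finset.mem_union]
        by_contra hcon
        push Not at hcon
        obtain ⟨h1, h2⟩ := hcon
        simp only [G, Finset.mem_filter, Finset.mem_univ, true_and, not_not] at h2
        apply h1
        have hyj : y j ≠ 0 := by
          intro hyj; rw [hyj] at h2; apply hj; linarith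
        simp only [I, Finset.mem_filter, hyU]
        refine ⟨hyj, ?_⟩
        rw [div_eq_iff hyj]; linarith
      have hIc : 1 ≤ I.card := Finset.card_pos.2 ⟨i0, hi0I⟩
      have hGc : 1 ≤ G.card := by
        rw [Nat.one_le_iff_ne_zero]
        intro hG
        rw [Finset.card_eq_zero] at hG
        have hz : ∀ j, z j = t * y j := by
          intro j
          by_contra hj
          have : j ∈ G := by
            simp only [G, Finset.mem_filter, Finset.mem_univ, true_and]
            intro h; apply hj; linarith
          rw [hG] at this; simp at this
        have : t = 1 := by
          have h1 : ∑ i, z i = t * ∑ i, y i := by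
            rw [Finset.mul_sum]; exact Finset.sum_congr rfl (fun j _ => hz j)
          rw [hzs, hys] at h1; linarith
        apply hne
        ext j
        rw [hz j, this, one_mul]
      have : I.card + G.card ≤ I.card * G.card + 1 := by nlinarith
      omega

structure Good (L : Set (n → ℝ)) (N : ℝ) : Prop where
  sum : ∀ x ∈ L, ∑ i, x i = 1
  pos : 0 < N
  int : ∀ P : Matrix n n ℝ, (∀ i, P i ∈ L) → ∃ z : ℤ, N * P.det = z

lemma Good.one_le {L : Set (n → ℝ)} {N : ℝ} (h : Good L N) (P : Matrix n n ℝ)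
    (hP : ∀ i, P i ∈ L) (hd : 0 < P.det) : 1 ≤ N * P.det := by
  obtain ⟨z, hz⟩ := h.int P hP
  have : 0 < N * P.det := mul_pos h.pos hd
  rw [hz] at this ⊢
  have : 0 < z := by exact_mod_cast this
  exact_mod_cast this

/-- Volume lower bound. -/
lemma vol_bound {L : Set (n → ℝ)} {N : ℝ} (h : Good L N) : ∀ (m : ℕ) (X : Finset (n → ℝ)),
    X.card = m → (∀ w ∈ X, w ∈ L) → ∀ P : Matrix n n ℝ, (∀ i, P i ∈ L) → 0 < P.det →
    1 + ((∑ w ∈ X, cost P w : ℕ) : ℝ) ≤ N * P.det := by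
  classical
  intro m
  induction m with
  | zero =>
    intro X hX _ P hP hd
    rw [Finset.card_eq_zero] at hX
    subst hX
    simpa using h.one_le P hP hd
  | succ m ih =>
    intro X hX hXL P hP hd
    by_cases hall : ∀ w ∈ X, cost P w = 0
    · rw [Finset.sum_eq_zero hall]
      simpa using h.one_le P hP hd
    push Not at hall
    obtain ⟨u, huX, hu⟩ := hall
    have hy0 : ∀ i, 0 ≤ crd P u i := by
      by_contra hc
      apply hu; unfold cost; rw [if_neg hc]
    have hrow : ∀ i, ∑ j, P i j = 1 := fun i => h.sum _ (hP i)
    have hys := sum_crd hd.ne' hrow (h.sum u (hXL u huX))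
    set y := crd P u with hy
    let U : Finset n := Finset.univ.filter (fun i => y i ≠ 0)
    have hUc : cost P u + 1 = U.card := by
      have h1 : cost P u = sz y - 1 := by unfold cost; rw [if_pos hy0]
      have h2 : sz y = U.card := rfl
      omega
    have hcard : (X.erase u).card = m := by rw [Finset.card_erase_of_mem huX, hX]; rfl
    have hNsum : N * P.det = ∑ i ∈ U, N * (P.updateRow i u).det := by
      have : ∀ i ∈ U, N * (P.updateRow i u).det = y i * (N * P.det) := by
        intro i _
        rw [det_updateRow_crd hd.ne']; ring
      rw [Finset.sum_congr rfl this, ← Finset.sum_mul]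
      have : ∑ i ∈ U, y i = 1 := by
        rw [← hys]
        exact Finset.sum_filter_ne_zero _
      rw [this, one_mul]
    have hstep : ∀ i ∈ U, 1 + ((∑ w ∈ X.erase u, cost (P.updateRow i u) w : ℕ) : ℝ)
        ≤ N * (P.updateRow i u).det := by
      intro i hi
      apply ih _ hcard (fun w hw => hXL w (Finset.mem_of_mem_erase hw))
      · intro j
        by_cases hj : j = i
        · subst hj; rw [Matrix.updateRow_self]; exact hXL u huX
        · rw [Matrix.updateRow_ne hj]; exact hP j
      · rw [det_updateRow_crd hd.ne']
        have : y i ≠ 0 := by simpa [U] using hi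
        exact mul_pos (lt_of_le_of_ne (hy0 i) (Ne.symm this)) hd
    have hpt : ∀ w ∈ X.erase u, cost P w ≤ ∑ i ∈ U, cost (P.updateRow i u) w := by
      intro w hw
      by_cases hz0 : ∀ i, 0 ≤ crd P w i
      · have hzs := sum_crd hd.ne' hrow (h.sum w (hXL w (Finset.mem_of_mem_erase hw)))
        have hne : crd P w ≠ y := by
          intro he
          apply Finset.ne_of_mem_erase hw
          rw [← crd_vecMul hd.ne' w, he, hy, crd_vecMul hd.ne']
        obtain ⟨I, hI1, hI2, hI3⟩ := stellar_step y (crd P w) hy0 hz0 hys hzs hne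
        have hIU : I ⊆ U := by
          intro i hi; simp [U, hI1 i hi]
        have hc : cost P w = sz (crd P w) - 1 := by unfold cost; rw [if_pos hz0]
        rw [hc]
        refine le_trans hI3 (le_trans (Finset.sum_le_sum ?_) (Finset.sum_le_sum_of_subset hIU))
        intro i hi
        have he := crd_updateRow hd.ne' i u w (hI1 i hi)
        unfold cost
        rw [he, if_pos]
        exact hI2 i hi
      · unfold cost
        rw [if_neg hz0]; exact Nat.zero_le _
    have hnat : 1 + ∑ w ∈ X, cost P w ≤ ∑ i ∈ U, (1 + ∑ w ∈ X.erase u, cost (P.updateRow i u) w) := by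
      rw [Finset.sum_add_distrib, Finset.sum_comm, ← Finset.add_sum_erase X _ huX]
      have := Finset.sum_le_sum hpt
      simp only [Finset.sum_const, smul_eq_mul, mul_one]
      omega
    rw [hNsum]
    refine le_trans ?_ (Finset.sum_le_sum hstep)
    exact_mod_cast hnat

end Core

section Chamber

variable {n : Type} [Fintype n] [DecidableEq n]

lemma lp_opt [Nonempty n] (a b c : n → ℝ) (ha : ∀ i, 0 < a i) (hb : ∀ i, 0 < b i)
    (hc : ∀ i, 0 < c i) (M : Finset n) (s s' : ℝ) (hs : 0 ≤ s) (hss : s < s')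
    (h1 : ∀ i ∈ M, b i ≤ s * a i) (h2 : ∀ j ∉ M, s' * a j ≤ b j) :
    ∃ α β : ℝ, 0 ≤ α ∧ 0 ≤ β ∧ (∀ j, 0 ≤ c j - α * a j - β * b j) ∧
      (α = 0 ∨ ∃ j ∉ M, c j - α * a j - β * b j = 0) ∧
      (β = 0 ∨ ∃ i ∈ M, c i - α * a i - β * b i = 0) ∧ (α ≠ 0 ∨ β ≠ 0) := by
  let K : Set (ℝ × ℝ) := {x | 0 ≤ x.1 ∧ 0 ≤ x.2 ∧ ∀ j, 0 ≤ c j - x.1 * a j - x.2 * b j}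
  obtain ⟨j0⟩ := ‹Nonempty n›
  have hKc : IsClosed K := by
    have : K = {x | 0 ≤ x.1} ∩ ({x | 0 ≤ x.2} ∩ ⋂ j, {x | 0 ≤ c j - x.1 * a j - x.2 * b j}) := by
      ext x; simp [K]
    rw [this]
    refine (isClosed_le (by fun_prop) (by fun_prop)).inter
      ((isClosed_le (by fun_prop) (by fun_prop)).inter (isClosed_iInter fun j => ?_))
    exact isClosed_le (by fun_prop) (by fun_prop)
  have hKs : K ⊆ Icc (0:ℝ) (c j0 / a j0) ×ˢ Icc (0:ℝ) (c j0 / b j0) := by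
    rintro ⟨x, y⟩ ⟨hx, hy, hxy⟩
    have := hxy j0
    simp only at hx hy this
    have e1 := mul_nonneg hx (ha j0).le
    have e2 := mul_nonneg hy (hb j0).le
    refine ⟨⟨hx, ?_⟩, ⟨hy, ?_⟩⟩
    · rw [le_div_iff₀ (ha j0)]; linarith
    · rw [le_div_iff₀ (hb j0)]; linarith
  have hK : IsCompact K := (isCompact_Icc.prod isCompact_Icc).of_isClosed_subset hKc hKs
  have hKne : K.Nonempty := ⟨(0, 0), by simp [K]; intro j; exact (hc j).le⟩
  obtain ⟨⟨α, β⟩, hmem, hmax⟩ := hK.exists_isMaxOn hKne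
    (f := fun x : ℝ × ℝ => x.1 + (s + s') / 2 * x.2) (by fun_prop)
  obtain ⟨hα, hβ, hγ⟩ := hmem
  simp only at hα hβ hγ
  have key : ∀ p q : ℝ, 0 < p + (s + s') / 2 * q → (0 ≤ p ∨ 0 < α) → (0 ≤ q ∨ 0 < β) →
      (∀ j, p * a j + q * b j ≤ 0 ∨ 0 < c j - α * a j - β * b j) → False := by
    intro p q hobj hp hq hj
    have lin : ∀ A B : ℝ, (0 ≤ B ∨ 0 < A) → 0 ≤ A → ∀ᶠ ε in nhdsWithin (0:ℝ) (Ioi 0), 0 ≤ A + ε * B := by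
      intro A B hAB hA
      rcases hAB with h | h
      · filter_upwards [self_mem_nhdsWithin] with ε hε
        have := mul_nonneg (le_of_lt hε) h
        linarith
      · have : Filter.Tendsto (fun ε : ℝ => A + ε * B) (nhdsWithin 0 (Ioi 0)) (nhds (A + 0 * B)) := by
          apply Filter.Tendsto.mono_left _ nhdsWithin_le_nhds
          exact Continuous.tendsto (by fun_prop) 0
        have h' := this.eventually (lt_mem_nhds (by simpa using h))
        filter_upwards [h'] with ε hε using le_of_lt hε
    have e1 := lin α p hp hα
    have e2 := lin β q hq hβ
    have e3 : ∀ᶠ ε in nhdsWithin (0:ℝ) (Ioi 0), ∀ j, 0 ≤ (c j - α * a j - β * b j) + ε * (-(p * a j + q * b j)) := by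
      rw [Filter.eventually_all]
      intro j
      apply lin _ _ _ (hγ j)
      rcases hj j with h | h
      · left; linarith
      · right; exact h
    obtain ⟨ε, ⟨hε1, hε2, hε3⟩, hε⟩ := ((e1.and (e2.and e3)).and self_mem_nhdsWithin).exists
    have hin : (α + ε * p, β + ε * q) ∈ K := by
      refine ⟨hε1, hε2, fun j => ?_⟩
      have := hε3 j
      simp only
      nlinarith
    have := hmax hin
    simp only [Set.mem_ofPred_eq] at this
    have h3 := mul_pos (show 0 < ε from hε) hobj
    nlinarith
  refine ⟨α, β, hα, hβ, hγ, ?_, ?_, ?_⟩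
  · by_contra hcon
    push Not at hcon
    obtain ⟨h3, h4⟩ := hcon
    refine key (-s) 1 (by linarith) (Or.inr (lt_of_le_of_ne hα (Ne.symm h3))) (Or.inl zero_le_one) ?_
    intro j
    by_cases hjM : j ∈ M
    · left; have := h1 j hjM; linarith
    · right; exact lt_of_le_of_ne (hγ j) (Ne.symm (h4 j hjM))
  · by_contra hcon
    push Not at hcon
    obtain ⟨h3, h4⟩ := hcon
    refine key s' (-1) (by linarith) (Or.inl (by linarith)) (Or.inr (lt_of_le_of_ne hβ (Ne.symm h3))) ?_
    intro j
    by_cases hjM : j ∈ M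
    · right; exact lt_of_le_of_ne (hγ j) (Ne.symm (h4 j hjM))
    · left; have := h2 j hjM; linarith
  · by_contra hcon
    push Not at hcon
    obtain ⟨h3, h4⟩ := hcon
    refine key 1 0 (by norm_num) (Or.inl zero_le_one) (Or.inl le_rfl) ?_
    intro j
    right
    rw [h3, h4]; simpa using hc j

lemma crd_one (w : n → ℝ) : crd (1 : Matrix n n ℝ) w = w := by
  apply crd_eq (by simp); simp

lemma det_upd1 (i : n) (a : n → ℝ) : ((1 : Matrix n n ℝ).updateRow i a).det = a i := by
  rw [det_updateRow_crd (by simp), crd_one]; simp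

lemma det_upd2 (i j : n) (hij : i ≠ j) (a b : n → ℝ) (ha : a i ≠ 0) :
    (((1 : Matrix n n ℝ).updateRow i a).updateRow j b).det = a i * b j - a j * b i := by
  rw [det_updateRow_crd (by rw [det_upd1]; exact ha), det_upd1, crd_updateRow (by simp), crd_one, crd_one]
  · rw [Function.update_of_ne hij.symm]
    simp; field_simp
  · rw [crd_one]; exact ha

lemma cost_upd1 (i : n) (a c : n → ℝ) (α : ℝ) (ha : a i ≠ 0) (hα : 0 < α)
    (hγ : ∀ j, 0 ≤ c j - α * a j) (hi : c i - α * a i = 0) :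
    cost ((1 : Matrix n n ℝ).updateRow i a) c = sz (fun j => c j - α * a j) := by
  have hcr : crd ((1 : Matrix n n ℝ).updateRow i a) c = Function.update (fun j => c j - α * a j) i α := by
    apply crd_eq (by rw [det_upd1]; exact ha)
    rw [vecMul_updateRow]
    ext j
    by_cases h : j = i
    · subst h; simp; linarith
    · simp [h]
  unfold cost
  rw [hcr, if_pos]
  · unfold sz
    have : (Finset.univ.filter (fun j => Function.update (fun j => c j - α * a j) i α j ≠ 0))
      = insert i (Finset.univ.filter (fun j => c j - α * a j ≠ 0)) := by
      ext j
      by_cases h : j = i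
      · subst h; simp [hα.ne']
      · simp [h]
    rw [this, Finset.card_insert_of_notMem (by simp [hi])]; simp
  · intro j
    by_cases h : j = i
    · subst h; simp [hα.le]
    · simp only [Function.update_of_ne h]; exact hγ j

lemma cost_upd2 (i j : n) (hij : i ≠ j) (a b c : n → ℝ) (α β : ℝ) (ha : a i ≠ 0)
    (hd : a i * b j - a j * b i ≠ 0) (hα : 0 ≤ α) (hβ : 0 ≤ β)
    (hγ : ∀ j, 0 ≤ c j - α * a j - β * b j) (hi : c i - α * a i - β * b i = 0)
    (hj : c j - α * a j - β * b j = 0) :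
    cost (((1 : Matrix n n ℝ).updateRow i a).updateRow j b) c =
      sz (fun j => c j - α * a j - β * b j) + (if α = 0 then 0 else 1) + (if β = 0 then 0 else 1) - 1 := by
  have hcr : crd (((1 : Matrix n n ℝ).updateRow i a).updateRow j b) c =
      Function.update (Function.update (fun j => c j - α * a j - β * b j) i α) j β := by
    apply crd_eq (by rw [det_upd2 i j hij a b ha]; exact hd)
    rw [vecMul_updateRow, vecMul_updateRow]
    ext l
    by_cases h : l = i
    · subst h; simp [hij]; linarith
    · by_cases h' : l = j
      · subst h'; simp [hij, h]; linarith
      · simp [h, h', hij]; ring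
  unfold cost
  rw [hcr, if_pos]
  · congr 1
    unfold sz
    set γ : n → ℝ := fun j => c j - α * a j - β * b j with hγd
    have e1 : (Finset.univ.filter (fun l => Function.update (Function.update γ i α) j β l ≠ 0))
      = (Finset.univ.filter (fun l => γ l ≠ 0)) ∪ ((if α = 0 then ∅ else {i}) ∪ (if β = 0 then ∅ else {j})) := by
      ext l
      have hi' : γ i = 0 := hi
      have hj' : γ j = 0 := hj
      by_cases h : l = i
      · subst h; by_cases hα0 : α = 0 <;> by_cases hβ0 : β = 0 <;> simp [hij, hi', hα0, hβ0]
      · by_cases h' : l = j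
        · subst h'; by_cases hα0 : α = 0 <;> by_cases hβ0 : β = 0 <;> simp [h, hj', hα0, hβ0]
        · by_cases hα0 : α = 0 <;> by_cases hβ0 : β = 0 <;> simp [h, h', hα0, hβ0]
    rw [e1, Finset.card_union_of_disjoint, Finset.card_union_of_disjoint]
    · by_cases hα0 : α = 0 <;> by_cases hβ0 : β = 0 <;> simp [hα0, hβ0, add_assoc]
    · by_cases hα0 : α = 0 <;> by_cases hβ0 : β = 0 <;> simp [hα0, hβ0, hij]
    · have hi' : γ i = 0 := hi
      have hj' : γ j = 0 := hj
      by_cases hα0 : α = 0 <;> by_cases hβ0 : β = 0 <;> simp [hα0, hβ0, hi', hj']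
  · intro l
    by_cases h' : l = j
    · subst h'; simp [hβ]
    · by_cases h : l = i
      · subst h; simp [hα, h']
      · simp only [Function.update_of_ne h, Function.update_of_ne h']; exact hγ l

/-- Total carrier dimension in the chamber triangulation. -/
lemma chamber_cost (a b c : n → ℝ) (ha : ∀ i, 0 < a i) (hb : ∀ i, 0 < b i)
    (hc : ∀ i, 0 < c i) (M : Finset n) (s s' : ℝ) (hs : 0 ≤ s) (hss : s < s')
    (h1 : ∀ i ∈ M, b i ≤ s * a i) (h2 : ∀ j ∉ M, s' * a j ≤ b j)
    (hsa : ∑ i, a i = 1) (hsb : ∑ i, b i = 1) (hsc : ∑ i, c i = 1) (hca : c ≠ a) (hcb : c ≠ b) :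
    Fintype.card n - 1 ≤ ∑ j ∈ Mᶜ, cost ((1 : Matrix n n ℝ).updateRow j a) c
      + ∑ i ∈ M, cost ((1 : Matrix n n ℝ).updateRow i b) c
      + ∑ i ∈ M, ∑ j ∈ Mᶜ, cost (((1 : Matrix n n ℝ).updateRow i a).updateRow j b) c := by
  have hdet : ∀ i ∈ M, ∀ j ∈ Mᶜ, i ≠ j ∧ a i * b j - a j * b i ≠ 0 := by
    intro i hi j hj
    rw [Finset.mem_compl] at hj
    refine ⟨fun h => hj (h ▸ hi), ?_⟩
    have e1 := h1 i hi
    have e2 := h2 j hj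
    have := mul_pos (ha i) (ha j)
    have f1 := mul_le_mul_of_nonneg_right e1 (ha j).le
    have f2 := mul_le_mul_of_nonneg_left e2 (ha i).le
    have f3 := mul_lt_mul_of_pos_right hss this
    nlinarith
  have hnon : Nonempty n := by
    by_contra hcon
    rw [not_nonempty_iff] at hcon
    simp at hsa
  obtain ⟨α, β, hα, hβ, hγ, t1, t2, t3⟩ := lp_opt a b c ha hb hc M s s' hs hss h1 h2
  let ZM := M.filter (fun i => c i - α * a i - β * b i = 0)
  let ZN := (Mᶜ).filter (fun i => c i - α * a i - β * b i = 0)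
  set g := sz (fun j => c j - α * a j - β * b j) with hg
  have hcard : Fintype.card n = ZM.card + ZN.card + g := by
    have : ZM.card + ZN.card = (Finset.univ.filter (fun i => c i - α * a i - β * b i = 0)).card := by
      rw [← Finset.card_union_of_disjoint, ← Finset.filter_union, Finset.union_compl]
      exact Finset.disjoint_filter_filter disjoint_compl_right
    rw [this, hg]
    unfold sz
    rw [Finset.card_filter_add_card_filter_not]; rfl
  have hT3 : ZM.card * (ZN.card * (g + (if α = 0 then 0 else 1) + (if β = 0 then 0 else 1) - 1)) ≤
      ∑ i ∈ M, ∑ j ∈ Mᶜ, cost (((1 : Matrix n n ℝ).updateRow i a).updateRow j b) c := by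
    have hsub : ∑ i ∈ ZM, ∑ j ∈ ZN, cost (((1 : Matrix n n ℝ).updateRow i a).updateRow j b) c ≤
        ∑ i ∈ M, ∑ j ∈ Mᶜ, cost (((1 : Matrix n n ℝ).updateRow i a).updateRow j b) c := by
      refine le_trans (Finset.sum_le_sum fun i _ =>
        Finset.sum_le_sum_of_subset (Finset.filter_subset _ _)) ?_
      exact Finset.sum_le_sum_of_subset (Finset.filter_subset _ _)
    refine le_trans (le_of_eq ?_) hsub
    have : ∀ i ∈ ZM, ∑ j ∈ ZN, cost (((1 : Matrix n n ℝ).updateRow i a).updateRow j b) c =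
        ZN.card * (g + (if α = 0 then 0 else 1) + (if β = 0 then 0 else 1) - 1) := by
      intro i hi
      rw [Finset.mem_filter] at hi
      rw [← smul_eq_mul, ← Finset.sum_const]
      apply Finset.sum_congr rfl
      intro j hj
      rw [Finset.mem_filter] at hj
      obtain ⟨d1, d2⟩ := hdet i hi.1 j hj.1
      exact cost_upd2 i j d1 a b c α β (ha i).ne' d2 hα hβ hγ hi.2 hj.2
    rw [Finset.sum_congr rfl this, Finset.sum_const, smul_eq_mul]
  have hprop : ∀ (x : n → ℝ) (r : ℝ), ∑ i, x i = 1 → (∀ j, c j - r * x j = 0) → c = x := by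
    intro x r hx hj
    have e : ∀ j, c j = r * x j := fun j => by linarith [hj j]
    have : r = 1 := by
      have h3 : ∑ i, c i = r * ∑ i, x i := by
        rw [Finset.mul_sum]; exact Finset.sum_congr rfl fun j _ => e j
      rw [hsc, hx] at h3; linarith
    ext j; rw [e j, this, one_mul]
  have hszpos : (∃ j, c j - α * a j - β * b j ≠ 0) → 1 ≤ g := by
    rintro ⟨j, hj⟩
    exact Finset.card_pos.2 ⟨j, by simp [hj]⟩
  by_cases hα0 : α = 0
  · have hβ0 : β ≠ 0 := by tauto
    have hg1 : 1 ≤ g := by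
      apply hszpos
      by_contra hcon
      push Not at hcon
      exact hcb (hprop b β hsb fun j => by have := hcon j; rw [hα0] at this; linarith)
    have hp : 1 ≤ ZM.card := by
      obtain ⟨i, hi, hi'⟩ := t2.resolve_left hβ0
      exact Finset.card_pos.2 ⟨i, Finset.mem_filter.2 ⟨hi, hi'⟩⟩
    have hT2 : ZM.card * g ≤ ∑ i ∈ M, cost ((1 : Matrix n n ℝ).updateRow i b) c := by
      refine le_trans (le_of_eq ?_) (Finset.sum_le_sum_of_subset (Finset.filter_subset
        (fun i => c i - α * a i - β * b i = 0) M))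
      rw [← smul_eq_mul, ← Finset.sum_const]
      apply Finset.sum_congr rfl
      intro i hi
      rw [Finset.mem_filter] at hi
      have e : ∀ j, c j - α * a j - β * b j = c j - β * b j := by intro j; rw [hα0]; ring
      rw [cost_upd1 i b c β (hb i).ne' (lt_of_le_of_ne hβ (Ne.symm hβ0))
        (fun j => by rw [← e]; exact hγ j) (by rw [← e]; exact hi.2), hg]
      simp only [e]
    rw [if_pos hα0, if_neg hβ0, add_zero, Nat.add_sub_cancel] at hT3
    have : ZM.card + ZN.card + g - 1 ≤ ZM.card * g + ZM.card * (ZN.card * g) := by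
      obtain ⟨p, hp'⟩ := Nat.exists_eq_add_of_le hp
      obtain ⟨r, hr⟩ := Nat.exists_eq_add_of_le hg1
      rw [hp', hr, Nat.sub_le_iff_le_add]
      ring_nf
      nlinarith [Nat.zero_le (p * r), Nat.zero_le (ZN.card * r), Nat.zero_le (ZN.card * p), Nat.zero_le (ZN.card * p * r)]
    omega
  · by_cases hβ0 : β = 0
    · have hg1 : 1 ≤ g := by
        apply hszpos
        by_contra hcon
        push Not at hcon
        exact hca (hprop a α hsa fun j => by have := hcon j; rw [hβ0] at this; linarith)
      have hp : 1 ≤ ZN.card := by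
        obtain ⟨i, hi, hi'⟩ := t1.resolve_left hα0
        exact Finset.card_pos.2 ⟨i, Finset.mem_filter.2 ⟨Finset.mem_compl.2 hi, hi'⟩⟩
      have hT1 : ZN.card * g ≤ ∑ i ∈ Mᶜ, cost ((1 : Matrix n n ℝ).updateRow i a) c := by
        refine le_trans (le_of_eq ?_) (Finset.sum_le_sum_of_subset (Finset.filter_subset
          (fun i => c i - α * a i - β * b i = 0) Mᶜ))
        rw [← smul_eq_mul, ← Finset.sum_const]
        apply Finset.sum_congr rfl
        intro i hi
        rw [Finset.mem_filter] at hi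
        have e : ∀ j, c j - α * a j - β * b j = c j - α * a j := by intro j; rw [hβ0]; ring
        rw [cost_upd1 i a c α (ha i).ne' (lt_of_le_of_ne hα (Ne.symm hα0))
          (fun j => by rw [← e]; exact hγ j) (by rw [← e]; exact hi.2), hg]
        simp only [e]
      rw [if_pos hβ0, if_neg hα0, add_zero, Nat.add_sub_cancel] at hT3
      have : ZM.card + ZN.card + g - 1 ≤ ZN.card * g + ZM.card * (ZN.card * g) := by
        obtain ⟨p, hp'⟩ := Nat.exists_eq_add_of_le hp
        obtain ⟨r, hr⟩ := Nat.exists_eq_add_of_le hg1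
        rw [hp', hr, Nat.sub_le_iff_le_add]
        ring_nf
        nlinarith [Nat.zero_le (p * r), Nat.zero_le (ZM.card * r), Nat.zero_le (ZM.card * p), Nat.zero_le (ZM.card * p * r)]
      omega
    · have hp : 1 ≤ ZN.card := by
        obtain ⟨i, hi, hi'⟩ := t1.resolve_left hα0
        exact Finset.card_pos.2 ⟨i, Finset.mem_filter.2 ⟨Finset.mem_compl.2 hi, hi'⟩⟩
      have hq : 1 ≤ ZM.card := by
        obtain ⟨i, hi, hi'⟩ := t2.resolve_left hβ0
        exact Finset.card_pos.2 ⟨i, Finset.mem_filter.2 ⟨hi, hi'⟩⟩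
      rw [if_neg hβ0, if_neg hα0, Nat.add_sub_cancel] at hT3
      have : ZM.card + ZN.card + g - 1 ≤ ZM.card * (ZN.card * (g + 1)) := by
        obtain ⟨p, hp'⟩ := Nat.exists_eq_add_of_le hp
        obtain ⟨r, hr⟩ := Nat.exists_eq_add_of_le hq
        rw [hp', hr, Nat.sub_le_iff_le_add]
        ring_nf
        nlinarith [Nat.zero_le (p * r), Nat.zero_le (g * r), Nat.zero_le (g * p), Nat.zero_le (g * p * r)]
      omega

/-- Volume bound from the chamber triangulation. -/
lemma chamber_bound {L : Set (n → ℝ)} {N : ℝ} (h : Good L N)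
    (hbas : ∀ i, (Pi.single i 1 : n → ℝ) ∈ L) (a b : n → ℝ)
    (haL : a ∈ L) (hbL : b ∈ L) (ha : ∀ i, 0 < a i) (hb : ∀ i, 0 < b i)
    (M : Finset n) (s s' : ℝ) (hs : 0 ≤ s) (hss : s < s')
    (h1 : ∀ i ∈ M, b i ≤ s * a i) (h2 : ∀ j ∉ M, s' * a j ≤ b j)
    (X : Finset (n → ℝ)) (hXL : ∀ w ∈ X, w ∈ L) (hXp : ∀ w ∈ X, ∀ i, 0 < w i)
    (hXa : a ∉ X) (hXb : b ∉ X) :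
    ((Mᶜ.card + M.card + M.card * Mᶜ.card + X.card * (Fintype.card n - 1) : ℕ) : ℝ) ≤ N := by
  have hrow1 : ∀ (i : n) (x : n → ℝ), x ∈ L → ∀ j, ((1 : Matrix n n ℝ).updateRow i x) j ∈ L := by
    intro i x hx j
    by_cases hj : j = i
    · subst hj; rw [Matrix.updateRow_self]; exact hx
    · rw [Matrix.updateRow_ne hj]
      convert hbas j using 1
      ext l; simp [Matrix.one_apply, Pi.single_apply, eq_comm]
  have hsa := h.sum a haL
  have hsb := h.sum b hbL
  have hdet : ∀ i ∈ M, ∀ j ∈ Mᶜ, i ≠ j ∧ 0 < a i * b j - a j * b i := by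
    intro i hi j hj
    rw [Finset.mem_compl] at hj
    refine ⟨fun h => hj (h ▸ hi), ?_⟩
    have e1 := h1 i hi
    have e2 := h2 j hj
    have := mul_pos (ha i) (ha j)
    have f1 := mul_le_mul_of_nonneg_right e1 (ha j).le
    have f2 := mul_le_mul_of_nonneg_left e2 (ha i).le
    have f3 := mul_lt_mul_of_pos_right hss this
    nlinarith
  have B1 : ∀ j ∈ Mᶜ, ((1 + ∑ w ∈ X, cost ((1 : Matrix n n ℝ).updateRow j a) w : ℕ) : ℝ) ≤ N * a j := by
    intro j _
    have := vol_bound h _ X rfl hXL ((1 : Matrix n n ℝ).updateRow j a) (hrow1 j a haL)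
      (by rw [det_upd1]; exact ha j)
    rw [det_upd1] at this
    exact_mod_cast this
  have B2 : ∀ j ∈ M, ((1 + ∑ w ∈ X, cost ((1 : Matrix n n ℝ).updateRow j b) w : ℕ) : ℝ) ≤ N * b j := by
    intro j _
    have := vol_bound h _ X rfl hXL ((1 : Matrix n n ℝ).updateRow j b) (hrow1 j b hbL)
      (by rw [det_upd1]; exact hb j)
    rw [det_upd1] at this
    exact_mod_cast this
  have B3 : ∀ i ∈ M, ∀ j ∈ Mᶜ,
      ((1 + ∑ w ∈ X, cost (((1 : Matrix n n ℝ).updateRow i a).updateRow j b) w : ℕ) : ℝ)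
        ≤ N * (a i * b j - a j * b i) := by
    intro i hi j hj
    obtain ⟨d1, d2⟩ := hdet i hi j hj
    have := vol_bound h _ X rfl hXL (((1 : Matrix n n ℝ).updateRow i a).updateRow j b) ?_
      (by rw [det_upd2 i j d1 a b (ha i).ne']; exact d2)
    · rw [det_upd2 i j d1 a b (ha i).ne'] at this
      exact_mod_cast this
    · intro l
      by_cases hl : l = j
      · subst hl; rw [Matrix.updateRow_self]; exact hbL
      · rw [Matrix.updateRow_ne hl]; exact hrow1 i a haL l
  have hid : N = ∑ j ∈ Mᶜ, N * a j + ∑ i ∈ M, N * b i + ∑ i ∈ M, ∑ j ∈ Mᶜ, N * (a i * b j - a j * b i) := by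
    have e1 : ∑ i ∈ M, a i + ∑ i ∈ Mᶜ, a i = 1 := by rw [Finset.sum_add_sum_compl, hsa]
    have e2 : ∑ i ∈ M, b i + ∑ i ∈ Mᶜ, b i = 1 := by rw [Finset.sum_add_sum_compl, hsb]
    have e3 : ∑ i ∈ M, ∑ j ∈ Mᶜ, N * (a i * b j - a j * b i) =
        N * ((∑ i ∈ M, a i) * (∑ i ∈ Mᶜ, b i) - (∑ i ∈ Mᶜ, a i) * (∑ i ∈ M, b i)) := by
      rw [Finset.sum_mul_sum, Finset.sum_mul_sum, Finset.sum_comm (s := Mᶜ), ← Finset.sum_sub_distrib,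
        Finset.mul_sum]
      apply Finset.sum_congr rfl
      intro i _
      rw [← Finset.sum_sub_distrib, Finset.mul_sum]
    rw [e3, ← Finset.mul_sum, ← Finset.mul_sum]
    have e4 : ∑ i ∈ Mᶜ, a i = 1 - ∑ i ∈ M, a i := by linarith
    have e5 : ∑ i ∈ Mᶜ, b i = 1 - ∑ i ∈ M, b i := by linarith
    rw [e4, e5]; ring
  have hnat : Mᶜ.card + M.card + M.card * Mᶜ.card + X.card * (Fintype.card n - 1) ≤
      ∑ j ∈ Mᶜ, (1 + ∑ w ∈ X, cost ((1 : Matrix n n ℝ).updateRow j a) w) +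
      ∑ j ∈ M, (1 + ∑ w ∈ X, cost ((1 : Matrix n n ℝ).updateRow j b) w) +
      ∑ i ∈ M, ∑ j ∈ Mᶜ, (1 + ∑ w ∈ X, cost (((1 : Matrix n n ℝ).updateRow i a).updateRow j b) w) := by
    have hw : ∑ w ∈ X, (Fintype.card n - 1) ≤ ∑ w ∈ X, (∑ j ∈ Mᶜ, cost ((1 : Matrix n n ℝ).updateRow j a) w
      + ∑ i ∈ M, cost ((1 : Matrix n n ℝ).updateRow i b) w
      + ∑ i ∈ M, ∑ j ∈ Mᶜ, cost (((1 : Matrix n n ℝ).updateRow i a).updateRow j b) w) := by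
      apply Finset.sum_le_sum
      intro w hw
      exact chamber_cost a b w ha hb (hXp w hw) M s s' hs hss h1 h2 hsa hsb (h.sum w (hXL w hw))
        (fun e => hXa (e ▸ hw)) (fun e => hXb (e ▸ hw))
    simp only [Finset.sum_add_distrib, Finset.sum_const, smul_eq_mul, mul_one] at hw ⊢
    rw [Finset.sum_comm (s := X) (t := Mᶜ), Finset.sum_comm (s := X) (t := M),
      Finset.sum_comm (s := X) (t := M)] at hw
    simp only [Finset.sum_comm (s := X) (t := Mᶜ)] at hw
    omega
  rw [hid]
  refine le_trans (Nat.cast_le.2 hnat) ?_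
  push_cast
  push_cast at B1 B2 B3
  refine add_le_add (add_le_add (Finset.sum_le_sum B1) (Finset.sum_le_sum B2)) ?_
  exact Finset.sum_le_sum fun i hi => Finset.sum_le_sum fun j hj => B3 i hi j hj

end Chamber

section Final

variable {n : Type} [Fintype n] [DecidableEq n]

lemma no_mid {L : Set (n → ℝ)} {N : ℝ} (h : Good L N)
    (hbas : ∀ i, (Pi.single i 1 : n → ℝ) ∈ L) (d k : ℕ) (hcard : Fintype.card n = d + 1)
    (hk : 2 ≤ k) (hN : N ≤ d * k + 1) (Y : Finset (n → ℝ)) (hYk : Y.card = k)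
    (hY : ∀ w, w ∈ Y ↔ w ∈ L ∧ ∀ i, 0 < w i) (a b : n → ℝ) (ha : a ∈ Y) (hb : b ∈ Y)
    (M : Finset n) (s s' : ℝ) (hs : 0 ≤ s) (hss : s < s')
    (h1 : ∀ i ∈ M, b i ≤ s * a i) (h2 : ∀ j ∉ M, s' * a j ≤ b j)
    (hm : 2 ≤ M.card) (hm' : M.card + 1 ≤ d) : False := by
  have hc := Finset.card_add_card_compl M
  rw [hcard] at hc
  obtain ⟨haL, hap⟩ := (hY a).1 ha
  obtain ⟨hbL, hbp⟩ := (hY b).1 hb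
  have hab : a ≠ b := by
    rintro rfl
    obtain ⟨i, hi⟩ : M.Nonempty := Finset.card_pos.1 (by omega)
    obtain ⟨j, hj⟩ : Mᶜ.Nonempty := Finset.card_pos.1 (by omega)
    have e1 := h1 i hi
    have e2 := h2 j (Finset.mem_compl.1 hj)
    have f1 : 1 ≤ s := by
      by_contra hcon; push Not at hcon; nlinarith [hap i]
    have f2 : s' ≤ 1 := by
      by_contra hcon; push Not at hcon; nlinarith [hap j]
    linarith
  have hB := chamber_bound h hbas a b haL hbL hap hbp M s s' hs hss h1 h2 ((Y.erase a).erase b)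
    (fun w hw => ((hY w).1 (Finset.mem_of_mem_erase (Finset.mem_of_mem_erase hw))).1)
    (fun w hw => ((hY w).1 (Finset.mem_of_mem_erase (Finset.mem_of_mem_erase hw))).2)
    (by simp) (by simp)
  rw [Finset.card_erase_of_mem (Finset.mem_erase.2 ⟨hab.symm, hb⟩), Finset.card_erase_of_mem ha,
    hYk, hcard] at hB
  have hB2 : Mᶜ.card + M.card + M.card * Mᶜ.card + (k - 1 - 1) * (d + 1 - 1) ≤ d * k + 1 := by
    have := hB.trans hN
    exact_mod_cast this
  obtain ⟨k', rfl⟩ := Nat.exists_eq_add_of_le hk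
  obtain ⟨x, hx⟩ := Nat.exists_eq_add_of_le hm
  obtain ⟨y, rfl⟩ := Nat.exists_eq_add_of_le hm'
  have e : Mᶜ.card = 2 + y := by omega
  have e2 : 2 + k' - 1 - 1 = k' := by omega
  rw [e, e2, hx, Nat.add_sub_cancel] at hB2
  nlinarith [Nat.zero_le (x * y)]

/-- The type II configuration with `r < 1` or `r = 1` is impossible. -/
lemma no_typeII {L : Set (n → ℝ)} {N : ℝ} (h : Good L N)
    (hbas : ∀ i, (Pi.single i 1 : n → ℝ) ∈ L) (d k : ℕ) (hcard : Fintype.card n = d + 1)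
    (hd : 3 ≤ d) (hk : 2 ≤ k) (hN : N ≤ d * k + 1) (Y : Finset (n → ℝ)) (hYk : Y.card = k)
    (hY : ∀ w, w ∈ Y ↔ w ∈ L ∧ ∀ i, 0 < w i)
    (htr : ∀ a ∈ L, ∀ b ∈ L, ∀ q, (Pi.single q 1 + a - b : n → ℝ) ∈ L)
    (hcl : ∀ y ∈ L, (∀ i, 0 ≤ y i) → (∃ i, y i = 0) → ∃ q, y = Pi.single q 1)
    (a b : n → ℝ) (ha : a ∈ Y) (hb : b ∈ Y) (p q : n) (hpq : p ≠ q) (r : ℝ) (hr1 : r ≤ 1)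
    (hmid : ∀ j, j ≠ p → j ≠ q → b j = r * a j) (hp : b p < r * a p)
    (hq : r * a q < b q) : False := by
  obtain ⟨haL, hap⟩ := (hY a).1 ha
  obtain ⟨hbL, hbp⟩ := (hY b).1 hb
  have hr0 : 0 < r := by
    by_contra hcon
    push Not at hcon
    nlinarith [hap p, hbp p]
  have hyL := htr a haL b hbL q
  set y : n → ℝ := Pi.single q 1 + a - b with hy
  have hyq : y q = 1 + a q - b q := by simp [hy]
  have hyp : y p = a p - b p := by simp [hy, hpq]
  have hym : ∀ j, j ≠ p → j ≠ q → y j = (1 - r) * a j := by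
    intro j h1 h2
    simp [hy, h2, hmid j h1 h2]; ring
  have hbq1 : b q < 1 := by
    have h1 := h.sum b hbL
    rw [← Finset.add_sum_erase _ _ (Finset.mem_univ q)] at h1
    have : 0 < ∑ x ∈ Finset.univ.erase q, b x :=
      Finset.sum_pos (fun i _ => hbp i) ⟨p, by simp [hpq]⟩
    linarith
  have hypp : 0 < y p := by rw [hyp]; nlinarith [hap p]
  have hyqp : 0 < y q := by rw [hyq]; linarith [hap q]
  have hMc : ((Finset.univ.erase p).erase q).card = d - 1 := by
    rw [Finset.card_erase_of_mem (by simp [hpq.symm]), Finset.card_erase_of_mem (by simp),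
      Finset.card_univ, hcard]; omega
  rcases hr1.eq_or_lt with h1 | h1
  · obtain ⟨j, hj⟩ : ((Finset.univ.erase p).erase q).Nonempty := Finset.card_pos.1 (by omega)
    simp only [Finset.mem_erase, Finset.mem_univ, and_true] at hj
    obtain ⟨z, hz⟩ := hcl y hyL (by
      intro i
      by_cases hip : i = p
      · subst hip; exact hypp.le
      by_cases hiq : i = q
      · subst hiq; exact hyqp.le
      rw [hym i hip hiq, h1]; simp) ⟨j, by rw [hym j hj.2 hj.1, h1]; simp⟩
    have e1 : z = p := by
      by_contra hc
      rw [hz, Pi.single_eq_of_ne (Ne.symm hc)] at hypp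
      exact lt_irrefl _ hypp
    have e2 : z = q := by
      by_contra hc
      rw [hz, Pi.single_eq_of_ne (Ne.symm hc)] at hyqp
      exact lt_irrefl _ hyqp
    exact hpq (e1.symm.trans e2)
  · have hyY : y ∈ Y := by
      rw [hY]
      refine ⟨hyL, ?_⟩
      intro i
      by_cases hip : i = p
      · subst hip; exact hypp
      by_cases hiq : i = q
      · subst hiq; exact hyqp
      rw [hym i hip hiq]
      exact mul_pos (by linarith) (hap i)
    have hpp : 1 - r < y p / a p := by
      rw [lt_div_iff₀ (hap p), hyp]; linarith
    have hqq : 1 - r < y q / a q := by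
      rw [lt_div_iff₀ (hap q), hyq]; nlinarith [hap q]
    refine no_mid h hbas d k hcard hk hN Y hYk hY a y ha hyY ((Finset.univ.erase p).erase q)
      (1 - r) (min (y p / a p) (y q / a q)) (by linarith) (lt_min hpp hqq) ?_ ?_ (by omega) (by omega)
    · intro i hi
      simp only [Finset.mem_erase, Finset.mem_univ, and_true] at hi
      rw [hym i hi.2 hi.1]
    · intro j hj
      simp only [Finset.mem_erase, Finset.mem_univ, and_true, not_and_or, not_not] at hj
      rw [← le_div_iff₀ (hap j)]
      rcases hj with rfl | rfl
      · exact min_le_right _ _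
      · exact min_le_left _ _

lemma bary_main {L : Set (n → ℝ)} {N : ℝ} (h : Good L N)
    (hbas : ∀ i, (Pi.single i 1 : n → ℝ) ∈ L) (d k : ℕ) (hcard : Fintype.card n = d + 1)
    (hd : 3 ≤ d) (hk : 2 ≤ k) (hN : N ≤ d * k + 1) (Y : Finset (n → ℝ)) (hYk : Y.card = k)
    (hY : ∀ w, w ∈ Y ↔ w ∈ L ∧ ∀ i, 0 < w i)
    (htr : ∀ a ∈ L, ∀ b ∈ L, ∀ q, (Pi.single q 1 + a - b : n → ℝ) ∈ L)
    (hcl : ∀ y ∈ L, (∀ i, 0 ≤ y i) → (∃ i, y i = 0) → ∃ q, y = Pi.single q 1)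
    (a b : n → ℝ) (ha : a ∈ Y) (hb : b ∈ Y) :
    ∃ (v : n) (r : ℝ), ∀ j, j ≠ v → b j = r * a j := by
  obtain ⟨haL, hap⟩ := (hY a).1 ha
  obtain ⟨hbL, hbp⟩ := (hY b).1 hb
  have hne : (Finset.univ : Finset n).Nonempty := Finset.card_pos.1 (by rw [Finset.card_univ]; omega)
  obtain ⟨p, -, hpmin⟩ := Finset.exists_min_image Finset.univ (fun i => b i / a i) hne
  have hne2 : ((Finset.univ : Finset n).erase p).Nonempty := Finset.card_pos.1 (by
    rw [Finset.card_erase_of_mem (by simp), Finset.card_univ]; omega)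
  obtain ⟨p2, hp2, hp2min⟩ := Finset.exists_min_image (Finset.univ.erase p) (fun i => b i / a i) hne2
  set r := b p2 / a p2 with hr
  have hr0 : 0 < r := div_pos (hbp _) (hap _)
  have hpr : b p / a p ≤ r := hpmin p2 (Finset.mem_univ _)
  have hjr : ∀ j, j ≠ p → r ≤ b j / a j := fun j hj => hp2min j (by simp [hj])
  let M : Finset n := Finset.univ.filter (fun i => b i / a i ≤ r)
  have hM2 : 2 ≤ M.card := by
    have : ({p, p2} : Finset n) ⊆ M := by
      intro i hi
      simp only [Finset.mem_insert, Finset.mem_singleton] at hi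
      rcases hi with rfl | rfl
      · simp [M, hpr]
      · simp [M, hr]
    have h2 := Finset.card_le_card this
    rw [Finset.card_pair (Finset.ne_of_mem_erase hp2).symm] at h2
    exact h2
  have hMd : d ≤ M.card := by
    by_contra hcon
    push Not at hcon
    have hc := Finset.card_add_card_compl M
    rw [hcard] at hc
    obtain ⟨j0, hj0, hj0min⟩ := Finset.exists_min_image Mᶜ (fun i => b i / a i)
      (Finset.card_pos.1 (by omega))
    refine no_mid h hbas d k hcard hk hN Y hYk hY a b ha hb M r (b j0 / a j0) hr0.le ?_ ?_ ?_ hM2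
      (by omega)
    · simpa [M] using hj0
    · intro i hi
      have : b i / a i ≤ r := by simpa [M] using hi
      rwa [div_le_iff₀ (hap i)] at this
    · intro j hj
      have := hj0min j (Finset.mem_compl.2 hj)
      rwa [le_div_iff₀ (hap j)] at this
  have hex : ∃ q, q ≠ p ∧ ∀ j, j ≠ q → b j / a j ≤ r := by
    have hc := Finset.card_add_card_compl M
    rw [hcard] at hc
    by_cases hemp : Mᶜ = ∅
    · refine ⟨p2, Finset.ne_of_mem_erase hp2, ?_⟩
      intro j _
      have : j ∈ M := by
        by_contra hj
        have : j ∈ Mᶜ := Finset.mem_compl.2 hj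
        rw [hemp] at this; simp at this
      simpa [M] using this
    · obtain ⟨q, hq⟩ := Finset.nonempty_iff_ne_empty.2 hemp
      refine ⟨q, ?_, ?_⟩
      · rintro rfl
        rw [Finset.mem_compl] at hq
        apply hq; simp [M, hpr]
      · intro j hj
        by_contra hcon
        have hj' : j ∈ Mᶜ := by simpa [M] using hcon
        exact hj (Finset.card_le_one.1 (show Mᶜ.card ≤ 1 by omega) j hj' q hq)
  obtain ⟨q, hqp, hq⟩ := hex
  have hmid : ∀ j, j ≠ p → j ≠ q → b j = r * a j := by
    intro j h1 h2
    rw [← div_eq_iff (hap j).ne']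
    exact le_antisymm (hq j h2) (hjr j h1)
  by_cases hpe : b p = r * a p
  · exact ⟨q, r, fun j hj => by
      by_cases hjp : j = p
      · rw [hjp]; exact hpe
      · exact hmid j hjp hj⟩
  by_cases hqe : b q = r * a q
  · exact ⟨p, r, fun j hj => by
      by_cases hjp : j = q
      · rw [hjp]; exact hqe
      · exact hmid j hj hjp⟩
  exfalso
  have hp' : b p < r * a p := by
    rw [div_le_iff₀ (hap p)] at hpr
    exact lt_of_le_of_ne hpr hpe
  have hq' : r * a q < b q := by
    have := hjr q hqp
    rw [le_div_iff₀ (hap q)] at this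
    exact lt_of_le_of_ne this (Ne.symm hqe)
  rcases le_total r 1 with h1 | h1
  · exact no_typeII h hbas d k hcard hd hk hN Y hYk hY htr hcl a b ha hb p q hqp.symm r h1 hmid hp' hq'
  · refine no_typeII h hbas d k hcard hd hk hN Y hYk hY htr hcl b a hb ha q p hqp r⁻¹
      (inv_le_one_of_one_le₀ h1) ?_ ?_ ?_
    · intro j h2 h3
      rw [hmid j h3 h2]; field_simp
    · rw [inv_mul_eq_div, lt_div_iff₀ hr0]; linarith
    · rw [inv_mul_eq_div, div_lt_iff₀ hr0]; linarith

end Final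

section Geometry

/-- the standard corner simplex. -/
def cornerS (d : ℕ) : Set (Fin d → ℝ) := {x | (∀ i, 0 ≤ x i) ∧ ∑ i, x i ≤ 1}

lemma volume_cornerS (d : ℕ) : (1 : ℝ≥0∞) / (Nat.factorial d : ℝ≥0∞) ≤ volume (cornerS d) := by
  let sg : (Fin d → Bool) → Fin d → ℝ := fun e i => if e i then 1 else -1
  have hsub : {x : Fin d → ℝ | ∑ i, |x i| ^ (1:ℝ) < 1} ⊆
      ⋃ e ∈ (Finset.univ : Finset (Fin d → Bool)), (Matrix.toLin' (Matrix.diagonal (sg e))) '' cornerS d := by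
    intro x hx
    have hx' : ∑ i, |x i| < 1 := by simpa using hx
    simp only [Set.mem_iUnion, Finset.mem_univ, exists_true_left]
    refine ⟨fun i => decide (0 ≤ x i), fun i => |x i|, ⟨fun i => abs_nonneg _, hx'.le⟩, ?_⟩
    ext i
    simp only [Matrix.toLin'_apply, Matrix.mulVec_diagonal, sg]
    by_cases h : 0 ≤ x i
    · simp [h, abs_of_nonneg h]
    · simp [h, abs_of_neg (not_le.1 h)]
  have hv := MeasureTheory.volume_sum_rpow_lt_one (Fin d) (p := 1) le_rfl
  have himg : ∀ e, volume ((Matrix.toLin' (Matrix.diagonal (sg e))) '' cornerS d) = volume (cornerS d) := by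
    intro e
    rw [Measure.addHaar_image_linearMap, LinearMap.det_toLin', Matrix.det_diagonal, Finset.abs_prod]
    have : ∀ i, |sg e i| = 1 := by
      intro i
      simp only [sg]
      split_ifs <;> simp
    simp [this]
  have h1 := (measure_mono hsub).trans (measure_biUnion_finset_le (μ := volume) Finset.univ
    (fun e => (Matrix.toLin' (Matrix.diagonal (sg e))) '' cornerS d))
  rw [hv] at h1
  simp only [himg, Finset.sum_const, Finset.card_univ, Fintype.card_fun, Fintype.card_bool,
    Fintype.card_fin, nsmul_eq_mul] at h1
  have e1 : (2 * Real.Gamma (1 / 1 + 1)) ^ d / Real.Gamma ((d:ℝ) / 1 + 1) = 2 ^ d / (Nat.factorial d : ℝ) := by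
    rw [div_one, div_one, Real.Gamma_nat_eq_factorial]
    norm_num
  rw [e1, ENNReal.ofReal_div_of_pos (by positivity)] at h1
  rw [ENNReal.ofReal_pow (by norm_num), ENNReal.ofReal_natCast] at h1
  simp only [ENNReal.ofReal_ofNat, Nat.cast_pow, Nat.cast_ofNat] at h1
  rw [← mul_one ((2:ℝ≥0∞) ^ d), mul_div_assoc, mul_one] at h1
  exact (ENNReal.mul_le_mul_iff_right (by positivity) (by finiteness)).1 h1

lemma det_hom (d : ℕ) (v : Fin (d + 1) → Fin d → ℝ) :
    (Matrix.of fun i => (Fin.cons 1 (v i) : Fin (d + 1) → ℝ)).det =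
      (Matrix.of fun (i : Fin d) j => v i.succ j - v 0 j).det := by
  have h := Matrix.det_eq_of_forall_row_eq_smul_add_const
    (A := Matrix.of fun i => (Fin.cons 1 (v i) : Fin (d + 1) → ℝ))
    (B := Matrix.of (Fin.cons (Fin.cons 1 (v 0)) (fun i : Fin d => Fin.cons 0 (fun j => v i.succ j - v 0 j)) :
      Fin (d+1) → Fin (d + 1) → ℝ))
    (Fin.cons 0 (fun _ => 1)) 0 (by simp) (by
      intro i j
      refine Fin.cases ?_ (fun i => ?_) i <;> refine Fin.cases ?_ (fun j => ?_) j <;> simp)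
  rw [h, Matrix.det_succ_column_zero, Fin.sum_univ_succ]
  simp
  congr 1

lemma vol_simplex (d : ℕ) (v : Fin (d + 1) → Fin d → ℝ) :
    volume (convexHull ℝ (Set.range v)) =
      ENNReal.ofReal |(Matrix.of fun i => (Fin.cons 1 (v i) : Fin (d + 1) → ℝ)).det| * volume (cornerS d) := by
  rw [det_hom]
  set B : Matrix (Fin d) (Fin d) ℝ := Matrix.of fun (i : Fin d) j => v i.succ j - v 0 j with hB
  have hT : convexHull ℝ (Set.range v) = (fun x => v 0 + x) '' ((Matrix.toLin' B.transpose) '' cornerS d) := by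
    rw [Set.image_image]
    have hf : ∀ x : Fin d → ℝ, v 0 + Matrix.toLin' B.transpose x = (1 - ∑ i, x i) • v 0 + ∑ i : Fin d, x i • v i.succ := by
      intro x
      ext j
      simp only [Matrix.toLin'_apply, Matrix.mulVec, dotProduct, hB, Matrix.transpose_apply, Matrix.of_apply,
        Pi.add_apply, Pi.smul_apply, smul_eq_mul, Finset.sum_apply, sub_mul, one_mul, Finset.sum_mul]
      simp only [mul_comm _ (x _), Finset.sum_sub_distrib]
      ring
    apply Set.Subset.antisymm
    · intro x hx
      rw [convexHull_range_eq_exists_affineCombination] at hx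
      obtain ⟨s, w, hw0, hw1, rfl⟩ := hx
      let w' : Fin (d+1) → ℝ := fun i => if i ∈ s then w i else 0
      have hw'0 : ∀ i, 0 ≤ w' i := by
        intro i; simp only [w']; split_ifs with h
        · exact hw0 i h
        · exact le_rfl
      have hw'1 : ∑ i, w' i = 1 := by simp [w', hw1]
      rw [Finset.affineCombination_eq_linear_combination _ _ _ hw1]
      refine ⟨fun i => w' i.succ, ⟨fun i => hw'0 _, ?_⟩, ?_⟩
      · rw [Fin.sum_univ_succ] at hw'1
        linarith [hw'0 0]
      · simp only
        rw [hf]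
        have : ∑ i ∈ s, w i • v i = ∑ i, w' i • v i := by
          simp [w', ite_smul]
        rw [this, Fin.sum_univ_succ]
        rw [Fin.sum_univ_succ] at hw'1
        congr 2
        linarith
    · rintro _ ⟨x, ⟨hx0, hx1⟩, rfl⟩
      simp only
      rw [hf]
      let w' : Fin (d+1) → ℝ := Fin.cons (1 - ∑ i, x i) x
      have : (1 - ∑ i, x i) • v 0 + ∑ i : Fin d, x i • v i.succ = ∑ i, w' i • v i := by
        rw [Fin.sum_univ_succ]; simp [w']
      rw [this]
      apply (convex_convexHull ℝ _).sum_mem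
      · intro i _
        refine Fin.cases ?_ (fun i => ?_) i
        · simp [w', hx1]
        · simp [w', hx0]
      · rw [Fin.sum_univ_succ]; simp [w']
      · intro i _
        exact subset_convexHull ℝ _ ⟨i, rfl⟩
  rw [hT, Set.image_add_left, measure_preimage_add, Measure.addHaar_image_linearMap, LinearMap.det_toLin',
    Matrix.det_transpose]

/-- barycentric vectors of lattice points. -/
def latL (d : ℕ) (v : Fin (d + 1) → Fin d → ℤ) : Set (Fin (d + 1) → ℝ) :=
  {x | ∑ i, x i = 1 ∧ IsLatticePt d (fun j => ∑ i, x i * (v i j : ℝ))}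

lemma good_latL (d : ℕ) (v : Fin (d + 1) → Fin d → ℤ)
    (hdet : (Matrix.of fun i => (Fin.cons 1 (fun j => (v i j : ℝ)) : Fin (d + 1) → ℝ)).det ≠ 0) :
    Good (latL d v) |(Matrix.of fun i => (Fin.cons 1 (fun j => (v i j : ℝ)) : Fin (d + 1) → ℝ)).det| := by
  refine ⟨fun x hx => hx.1, abs_pos.2 hdet, ?_⟩
  intro P hP
  set A := (Matrix.of fun i => (Fin.cons 1 (fun j => (v i j : ℝ)) : Fin (d + 1) → ℝ)) with hA
  have hint : ∀ i j, ∃ z : ℤ, (P * A) i j = z := by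
    intro i j
    refine Fin.cases ?_ (fun j => ?_) j
    · refine ⟨1, ?_⟩
      simp [Matrix.mul_apply, hA, (hP i).1]
    · obtain ⟨z, hz⟩ := (hP i).2 j
      refine ⟨z, ?_⟩
      rw [← hz]
      simp [Matrix.mul_apply, hA]
  choose Z hZ using hint
  have hdetZ : P.det * A.det = ((Matrix.of Z).det : ℤ) := by
    rw [← Matrix.det_mul]
    have : P * A = (Matrix.of Z).map (Int.castRingHom ℝ) := by
      ext i j; simp [hZ]
    rw [this, ← RingHom.mapMatrix_apply, ← RingHom.map_det]; simp
  rcases abs_choice A.det with h | h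
  · exact ⟨(Matrix.of Z).det, by rw [h, mul_comm, hdetZ]⟩
  · exact ⟨-(Matrix.of Z).det, by rw [h, Int.cast_neg, ← hdetZ]; ring⟩

end Geometry

/-- In a minimal-volume clean `k`-point lattice `d`-simplex (`d ≥ 3`,
`k ≥ 2`), any two distinct interior lattice points are collinear with some vertex. -/
theorem two_interior_points_collinear_with_vertex (d k : ℕ) (hd : 3 ≤ d) (hk : 2 ≤ k)
    (T : Set (Fin d → ℝ)) (hT : IsLatticeSimplex d T) (hclean : IsClean d T)
    (hint : {x ∈ interior T | IsLatticePt d x}.ncard = k)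
    (hvol : volume T = ((d * k + 1 : ℕ) : ℝ≥0∞) / (Nat.factorial d : ℝ≥0∞))
    (w₁ w₂ : Fin d → ℝ) (hw₁ : w₁ ∈ interior T) (hw₂ : w₂ ∈ interior T)
    (hl₁ : IsLatticePt d w₁) (hl₂ : IsLatticePt d w₂) (hne : w₁ ≠ w₂) :
    ∃ v ∈ Set.extremePoints ℝ T, Collinear ℝ {w₁, w₂, v} := by
  classical
  obtain ⟨v, hind, hTe⟩ := hT
  set V : Fin (d + 1) → Fin d → ℝ := fun i => fun j => ((v i j : ℤ) : ℝ) with hV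
  have htot : affineSpan ℝ (Set.range V) = ⊤ := by
    rw [hind.affineSpan_eq_top_iff_card_eq_finrank_add_one]; simp
  let bb : AffineBasis (Fin (d + 1)) ℝ (Fin d → ℝ) := ⟨V, hind, htot⟩
  have hbb : ∀ i, bb i = V i := fun i => rfl
  have hTb : T = convexHull ℝ (Set.range bb) := hTe
  have hTc : T = {x | ∀ i, 0 ≤ bb.coord i x} := by rw [hTb, bb.convexHull_eq_nonneg_coord]
  have hTi : interior T = {x | ∀ i, 0 < bb.coord i x} := by rw [hTb, bb.interior_convexHull]
  let co : (Fin d → ℝ) → Fin (d + 1) → ℝ := fun x i => bb.coord i x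
  have hself : ∀ x, (fun j => ∑ i, co x i * (v i j : ℝ)) = x := by
    intro x
    have := bb.linear_combination_coord_eq_self x
    conv_rhs => rw [← this]
    ext j
    simp [co, hbb, hV]
  have hcosum : ∀ x, ∑ i, co x i = 1 := fun x => bb.sum_coord_apply_eq_one x
  have hco : ∀ y : Fin (d + 1) → ℝ, ∑ i, y i = 1 → co (fun j => ∑ i, y i * (v i j : ℝ)) = y := by
    intro y hy
    have : (fun j => ∑ i, y i * (v i j : ℝ)) = Finset.univ.affineCombination ℝ bb y := by
      rw [Finset.affineCombination_eq_linear_combination _ _ _ hy]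
      ext j; simp [hbb, hV]
    ext i
    rw [this]
    exact bb.coord_apply_combination_of_mem (Finset.mem_univ i) hy
  have hcoL : ∀ x, IsLatticePt d x → co x ∈ latL d v := by
    intro x hx
    exact ⟨hcosum x, by rw [hself]; exact hx⟩
  have hcoinj : Function.Injective co := by
    intro x y hxy
    rw [← hself x, ← hself y, hxy]
  -- volume
  have hvs := vol_simplex d V
  set A := (Matrix.of fun i => (Fin.cons 1 (V i) : Fin (d + 1) → ℝ)) with hA
  rw [← hTe, hvol] at hvs
  have hdet : A.det ≠ 0 := by
    intro h0
    rw [h0] at hvs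
    simp at hvs
  have hN : |A.det| ≤ d * k + 1 := by
    have h1 : ENNReal.ofReal |A.det| * (1 / (Nat.factorial d : ℝ≥0∞)) ≤
        ((d * k + 1 : ℕ) : ℝ≥0∞) * (1 / (Nat.factorial d : ℝ≥0∞)) := by
      rw [mul_one_div ((d * k + 1 : ℕ) : ℝ≥0∞), hvs]
      exact mul_le_mul_right (volume_cornerS d) _
    have h2 := (ENNReal.mul_le_mul_iff_left (by simp) (by
      simp [Nat.factorial_ne_zero])).1 h1
    rw [ENNReal.ofReal_le_natCast] at h2
    exact_mod_cast h2
  have hgood : Good (latL d v) |A.det| := good_latL d v hdet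
  have hbas : ∀ i, (Pi.single i 1 : Fin (d + 1) → ℝ) ∈ latL d v := by
    intro i
    refine ⟨by simp, fun j => ⟨v i j, ?_⟩⟩
    simp [Pi.single_apply]
  have htr : ∀ a ∈ latL d v, ∀ b ∈ latL d v, ∀ q,
      (Pi.single q 1 + a - b : Fin (d + 1) → ℝ) ∈ latL d v := by
    intro a ha b hb q
    refine ⟨?_, fun j => ?_⟩
    · simp [Finset.sum_sub_distrib, Finset.sum_add_distrib, ha.1, hb.1]
    · obtain ⟨x, hx⟩ := ha.2 j
      obtain ⟨y, hy⟩ := hb.2 j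
      refine ⟨v q j + x - y, ?_⟩
      push_cast
      rw [← hx, ← hy]
      simp [sub_mul, add_mul, Finset.sum_sub_distrib, Finset.sum_add_distrib, Pi.single_apply]
  have hclosed : IsClosed T := by
    rw [hTe]
    exact (Set.finite_range V).isClosed_convexHull ℝ
  have hfr : ∀ x, IsLatticePt d x → x ∈ T → (∃ i, co x i = 0) → x ∈ Set.extremePoints ℝ T := by
    intro x hx hxT hx0
    rw [← hclean]
    refine ⟨⟨subset_closure hxT, ?_⟩, hx⟩
    rw [hTi]
    obtain ⟨i, hi⟩ := hx0
    intro h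
    have := h i
    exact absurd hi this.ne'
  have hcl : ∀ y ∈ latL d v, (∀ i, 0 ≤ y i) → (∃ i, y i = 0) → ∃ q, y = Pi.single q 1 := by
    intro y hy hy0 hyz
    have hc := hco y hy.1
    have hm := hfr _ hy.2 (by rw [hTc]; intro i; have := congrFun hc i; simp only [co] at this; rw [this]; exact hy0 i)
      (by rw [hc]; exact hyz)
    rw [hTe] at hm
    obtain ⟨q, hq⟩ := extremePoints_convexHull_subset hm
    refine ⟨q, ?_⟩
    rw [← hc, ← hq]
    ext i
    simp only [co, ← hbb, bb.coord_apply, Pi.single_apply]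
  -- interior points
  set S := {x ∈ interior T | IsLatticePt d x} with hS
  have hSf : S.Finite := by
    apply Set.finite_of_ncard_ne_zero
    omega
  let Y : Finset (Fin (d + 1) → ℝ) := hSf.toFinset.image co
  have hYk : Y.card = k := by
    rw [Finset.card_image_of_injective _ hcoinj, ← Set.ncard_eq_toFinset_card _ hSf, hint]
  have hY : ∀ w, w ∈ Y ↔ w ∈ latL d v ∧ ∀ i, 0 < w i := by
    intro w
    simp only [Y, Finset.mem_image, Set.Finite.mem_toFinset]
    constructor
    · rintro ⟨x, hx, rfl⟩
      refine ⟨hcoL x hx.2, ?_⟩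
      have := hx.1
      rw [hTi] at this
      exact this
    · rintro ⟨h1, h2⟩
      refine ⟨_, ⟨?_, h1.2⟩, hco w h1.1⟩
      rw [hTi]
      intro i
      have := congrFun (hco w h1.1) i
      simp only [co] at this
      rw [this]; exact h2 i
  have hmem : ∀ x, x ∈ interior T → IsLatticePt d x → co x ∈ Y := by
    intro x h1 h2
    exact Finset.mem_image.2 ⟨x, hSf.mem_toFinset.2 ⟨h1, h2⟩, rfl⟩
  obtain ⟨q, r, hq⟩ := bary_main hgood hbas d k (by simp) hd hk hN Y hYk hY htr hcl (co w₁) (co w₂)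
    (hmem _ hw₁ hl₁) (hmem _ hw₂ hl₂)
  have hcoV : ∀ i, co (V q) i = if i = q then 1 else 0 := by
    intro i
    simp only [co, ← hbb, bb.coord_apply]
  refine ⟨V q, ?_, ?_⟩
  · apply hfr
    · intro j; exact ⟨v q j, rfl⟩
    · rw [hTe]; exact subset_convexHull ℝ _ ⟨q, rfl⟩
    · obtain ⟨i, hi⟩ : ∃ i : Fin (d + 1), i ≠ q := by
        have : Nontrivial (Fin (d + 1)) := Fin.nontrivial_iff_two_le.2 (by omega)
        exact exists_ne q
      exact ⟨i, by rw [hcoV, if_neg hi]⟩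
  · rw [Set.insert_comm]
    apply collinear_insert_of_mem_affineSpan_pair
    have hval : co w₂ q = r * co w₁ q + (1 - r) := by
      have s1 := hcosum w₁
      have s2 := hcosum w₂
      rw [← Finset.add_sum_erase _ _ (Finset.mem_univ q)] at s1 s2
      have : ∑ x ∈ Finset.univ.erase q, co w₂ x = r * ∑ x ∈ Finset.univ.erase q, co w₁ x := by
        rw [Finset.mul_sum]
        exact Finset.sum_congr rfl fun j hj => hq j (Finset.ne_of_mem_erase hj)
      rw [this] at s2
      linear_combination s2 - r * s1
    have hw : w₂ = AffineMap.lineMap w₁ (V q) (1 - r) := by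
      apply hcoinj
      ext i
      have e : co (AffineMap.lineMap w₁ (V q) (1 - r)) i = AffineMap.lineMap (co w₁ i) (co (V q) i) (1 - r) := by
        simp only [co]
        rw [AffineMap.apply_lineMap]
      rw [e, hcoV, AffineMap.lineMap_apply_module]
      by_cases hi : i = q
      · subst hi; rw [hval]; simp
      · rw [hq i hi]; simp [hi]
    rw [hw]
    exact AffineMap.lineMap_mem_affineSpan_pair _ _ _
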